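/- Semiskolemian subsets of (ℕ_{>0})^d are closed under complementation within (ℕ_{>0})^d. -/

import Mathlib

/-- Componentwise `p`-adic valuation of a vector `w ∈ ℕ^d`. -/
def vp {d : ℕ} (p : ℕ) (w : Fin d → ℕ) : Fin d → ℕ := fun t => padicValNat p (w t)

/-- The skolemian set `Def(α₁, …; α)` determined by a family of exceptional
semilinear sets `αs` (indexed by `ι`) and a default set `α`: the set of vectors
`w ∈ (ℕ_{>0})^d` such that there are pairwise distinct primes `p i` with
`vp (p i) w ∈ αs i`, and `vp q w ∈ α` for every other prime `q` with
`vp q w ≠ 0`. -/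
def SkolemDef {d : ℕ} {ι : Type} (αs : ι → Set (Fin d → ℕ)) (α : Set (Fin d → ℕ)) :
    Set (Fin d → ℕ) :=
  {w | (∀ t, 0 < w t) ∧ ∃ p : ι → ℕ,
    (∀ i, (p i).Prime) ∧ Function.Injective p ∧
    (∀ i, vp (p i) w ∈ αs i) ∧
    ∀ q : ℕ, q.Prime → (∀ i, p i ≠ q) → vp q w ≠ 0 → vp q w ∈ α}

/-- A linear subset of `ℕ^d`: a base vector plus arbitrary `ℕ`-combinations of
finitely many period vectors. -/
def IsLinear {d : ℕ} (A : Set (Fin d → ℕ)) : Prop :=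
  ∃ (b : Fin d → ℕ) (k : ℕ) (per : Fin k → Fin d → ℕ),
    A = {v | ∃ c : Fin k → ℕ, v = b + ∑ j, c j • per j}

/-- A semilinear subset of `ℕ^d`: a finite union of linear sets. -/
def IsSemilinear {d : ℕ} (A : Set (Fin d → ℕ)) : Prop :=
  ∃ (m : ℕ) (L : Fin m → Set (Fin d → ℕ)), (∀ i, IsLinear (L i)) ∧ A = ⋃ i, L i

/-- A skolemian subset of `(ℕ_{>0})^d`. -/
def IsSkolemian {d : ℕ} (S : Set (Fin d → ℕ)) : Prop :=
  ∃ (n : ℕ) (αs : Fin n → Set (Fin d → ℕ)) (α : Set (Fin d → ℕ)),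
    (∀ i, IsSemilinear (αs i)) ∧ IsSemilinear α ∧ (0 : Fin d → ℕ) ∈ α ∧
    (∀ i, (0 : Fin d → ℕ) ∉ αs i) ∧ S = SkolemDef αs α

/-- A semiskolemian set: a finite union of skolemian sets. -/
def IsSemiskolemian {d : ℕ} (S : Set (Fin d → ℕ)) : Prop :=
  ∃ (m : ℕ) (T : Fin m → Set (Fin d → ℕ)), (∀ i, IsSkolemian (T i)) ∧ S = ⋃ i, T i

/-- `M` is a matching in the bipartite graph with edge set `E ⊆ L × R`:
a set of pairwise non-adjacent edges. -/
def IsBipMatching {L R : Type*} (E M : Set (L × R)) : Prop :=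
  M ⊆ E ∧ ∀ e ∈ M, ∀ f ∈ M, e ≠ f → e.1 ≠ f.1 ∧ e.2 ≠ f.2

/-- `M` covers every left vertex in `L'`. -/
def CoversL {L R : Type*} (M : Set (L × R)) (L' : Set L) : Prop :=
  ∀ l ∈ L', ∃ e ∈ M, e.1 = l

/-- `M` covers every right vertex in `R'`. -/
def CoversR {L R : Type*} (M : Set (L × R)) (R' : Set R) : Prop :=
  ∀ r ∈ R', ∃ e ∈ M, e.2 = r

open Pointwise in
theorem isLinear_iff_isLinearSet {d : ℕ} (A : Set (Fin d → ℕ)) : IsLinear A ↔ IsLinearSet A := by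
  rw [isLinearSet_iff_exists_fin_addMonoidHom]
  constructor
  · rintro ⟨b, k, per, rfl⟩
    refine ⟨b, k, (Fintype.linearCombination ℕ per).toAddMonoidHom, ?_⟩
    ext v
    simp [Set.mem_vadd_set, Fintype.linearCombination_apply, eq_comm]
  · rintro ⟨b, k, f, rfl⟩
    refine ⟨b, k, fun j => f (Pi.single j 1), ?_⟩
    ext v
    have h : ∀ c : Fin k → ℕ, f c = ∑ j, c j • f (Pi.single j 1) := by
      intro c
      conv_lhs => rw [← Finset.univ_sum_single c]
      rw [map_sum]
      refine Finset.sum_congr rfl fun j _ => ?_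
      rw [← map_nsmul, ← Pi.single_smul]
      simp
    constructor
    · rintro ⟨_, ⟨c, rfl⟩, rfl⟩
      exact ⟨c, by rw [← h c]; rfl⟩
    · rintro ⟨c, hc⟩
      exact ⟨f c, ⟨c, rfl⟩, by rw [hc, ← h c]; rfl⟩

theorem isSemilinear_iff_set {d : ℕ} (A : Set (Fin d → ℕ)) :
    IsSemilinear A ↔ IsSemilinearSet A := by
  constructor
  · rintro ⟨m, L, hL, rfl⟩
    exact IsSemilinearSet.iUnion fun i => ((isLinear_iff_isLinearSet _).1 (hL i)).isSemilinearSet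
  · rw [isSemilinearSet_iff]
    rintro ⟨S, hS, rfl⟩
    refine ⟨S.card, fun i => (S.equivFin.symm i : Set (Fin d → ℕ)), fun i =>
      (isLinear_iff_isLinearSet _).2 (hS _ (S.equivFin.symm i).2), ?_⟩
    ext v
    simp only [Set.mem_sUnion, Set.mem_iUnion]
    constructor
    · rintro ⟨t, ht, hv⟩
      exact ⟨S.equivFin ⟨t, ht⟩, by simpa using hv⟩
    · rintro ⟨i, hi⟩
      exact ⟨_, (S.equivFin.symm i).2, hi⟩

theorem exists_matching {ι C : Type*} [Finite ι] (P : C → Set ℕ)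
    (hdis : ∀ a b q, q ∈ P a → q ∈ P b → a = b) (hfin : ∀ a, (P a).Finite) (κ : ι → C)
    (h : ∀ a, Nat.card {i // κ i = a} ≤ (P a).ncard) :
    ∃ p : ι → ℕ, Function.Injective p ∧ (∀ i, p i ∈ P (κ i)) ∧
      ∀ a, (P a).ncard ≤ Nat.card {i // κ i = a} → ∀ q ∈ P a, ∃ i, κ i = a ∧ p i = q := by
  have h1 : ∀ a, ∃ f : {i // κ i = a} → P a, Function.Injective f := by
    intro a
    have := (hfin a).to_subtype
    have := Fintype.ofFinite (P a)
    have := Fintype.ofFinite {i // κ i = a}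
    have h2 := h a
    rw [← Nat.card_coe_set_eq, Nat.card_eq_fintype_card, Nat.card_eq_fintype_card] at h2
    obtain ⟨f⟩ := Function.Embedding.nonempty_of_card_le h2
    exact ⟨f, f.injective⟩
  choose f hf using h1
  refine ⟨fun i => f (κ i) ⟨i, rfl⟩, ?_, fun i => (f (κ i) ⟨i, rfl⟩).2, ?_⟩
  · intro i j hij
    have hκ : κ i = κ j := hdis _ _ _ (f (κ i) ⟨i, rfl⟩).2 (by
      have := (f (κ j) ⟨j, rfl⟩).2
      simp only at hij
      rwa [← hij] at this)
    have key : ∀ (a : C) (hi : κ i = a) (hj : κ j = a),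
        ((f a ⟨i, hi⟩ : P a) : ℕ) = f a ⟨j, hj⟩ → i = j := by
      intro a hi hj e
      have := hf a (Subtype.ext e)
      simpa using this
    have key2 : ∀ (a : C) (hi : κ i = a),
        ((f (κ i) ⟨i, rfl⟩ : P (κ i)) : ℕ) = f a ⟨i, hi⟩ := by
      rintro a rfl; rfl
    refine key (κ j) hκ rfl ?_
    rw [← key2]
    exact hij
  · intro a ha q hq
    have := (hfin a).to_subtype
    rw [← Nat.card_coe_set_eq] at ha
    have hb := (hf a).bijective_of_nat_card_le ha
    obtain ⟨⟨i, rfl⟩, hi⟩ := hb.2 ⟨q, hq⟩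
    exact ⟨i, rfl, by simp [hi]⟩

/-- primes whose valuation vector is nonzero of color `a` -/
def colorPrimes {d : ℕ} {C : Type} (χ : (Fin d → ℕ) → C) (w : Fin d → ℕ) (a : C) : Set ℕ :=
  {q | q.Prime ∧ vp q w ≠ 0 ∧ χ (vp q w) = a}

theorem colorPrimes_finite {d : ℕ} {C : Type} (χ : (Fin d → ℕ) → C) (w : Fin d → ℕ)
    (a : C) : (colorPrimes χ w a).Finite := by
  refine Set.Finite.subset (Set.finite_iUnion fun t => (w t).primeFactors.finite_toSet) ?_
  rintro q ⟨hp, hq, -⟩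
  obtain ⟨t, ht⟩ := Function.ne_iff.1 hq
  simp only [Set.mem_iUnion]
  refine ⟨t, ?_⟩
  simp only [vp, Pi.zero_apply, ne_eq, padicValNat.eq_zero_iff, not_or, not_not] at ht
  exact Nat.mem_primeFactors.2 ⟨hp, ht.2.2, ht.2.1⟩

theorem colorPrimes_disj {d : ℕ} {C : Type} (χ : (Fin d → ℕ) → C) (w : Fin d → ℕ) :
    ∀ a b q, q ∈ colorPrimes χ w a → q ∈ colorPrimes χ w b → a = b := by
  rintro a b q ⟨-, -, h⟩ ⟨-, -, h'⟩
  exact h.symm.trans h'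

/-- vectors with prescribed truncated counts -/
def cell {d : ℕ} {C : Type} (χ : (Fin d → ℕ) → C) (N : ℕ) (c : C → Fin (N + 1)) :
    Set (Fin d → ℕ) :=
  {w | (∀ t, 0 < w t) ∧ ∀ a, min (colorPrimes χ w a).ncard N = c a}

theorem isSkolemian_of_finite {d : ℕ} {ι : Type} [Finite ι] (αs : ι → Set (Fin d → ℕ))
    (α : Set (Fin d → ℕ)) (h1 : ∀ i, IsSemilinear (αs i)) (h2 : IsSemilinear α)
    (h3 : (0 : Fin d → ℕ) ∈ α) (h4 : ∀ i, (0 : Fin d → ℕ) ∉ αs i) :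
    IsSkolemian (SkolemDef αs α) := by
  obtain ⟨n, ⟨e⟩⟩ := Finite.exists_equiv_fin ι
  refine ⟨n, αs ∘ e.symm, α, fun i => h1 _, h2, h3, fun i => h4 _, ?_⟩
  ext w
  constructor
  · rintro ⟨hw, p, hp, hi, hm, ho⟩
    refine ⟨hw, p ∘ e.symm, fun i => hp _, hi.comp e.symm.injective, fun i => hm _, ?_⟩
    intro q hq hne
    refine ho q hq fun i => ?_
    simpa using hne (e i)
  · rintro ⟨hw, p, hp, hi, hm, ho⟩
    refine ⟨hw, p ∘ e, fun i => hp _, hi.comp e.injective,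
      fun i => by simpa using hm (e i), ?_⟩
    intro q hq hne
    refine ho q hq fun i => ?_
    simpa using hne (e.symm i)

theorem card_sigma_fiber {C : Type} (c : C → ℕ) (a : C) :
    Nat.card {i : Σ a, Fin (c a) // i.1 = a} = c a := by
  rw [Nat.card_congr (Equiv.sigmaSubtype (β := fun a => Fin (c a)) a)]
  simp

theorem isSkolemian_cell {d : ℕ} {C : Type} [Finite C] (χ : (Fin d → ℕ) → C)
    (hχ : ∀ a, IsSemilinearSet {v | χ v = a}) (N : ℕ) (c : C → Fin (N + 1)) :
    IsSkolemian (cell χ N c) := by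
  have hs0 : IsSemilinearSet ({0} : Set (Fin d → ℕ)) := IsSemilinearSet.singleton 0
  have key : cell χ N c = SkolemDef (ι := Σ a, Fin (c a : ℕ))
      (fun i => {v | χ v = i.1} \ {0})
      ({0} ∪ ⋃ a : {a // (c a : ℕ) = N}, {v | χ v = a.1}) := by
    ext w
    constructor
    · rintro ⟨hw, hc⟩
      obtain ⟨p, hp, hm, hs⟩ := exists_matching (colorPrimes χ w) (colorPrimes_disj χ w)
        (colorPrimes_finite χ w) (fun i : Σ a, Fin (c a : ℕ) => i.1) (by
          intro a
          rw [card_sigma_fiber (fun a => (c a : ℕ)) a, ← hc a]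
          exact min_le_left _ _)
      refine ⟨hw, p, fun i => (hm i).1, hp, fun i => ⟨(hm i).2.2, (hm i).2.1⟩, ?_⟩
      intro q hq hne h0
      right
      simp only [Set.mem_iUnion, Set.mem_ofPred_eq]
      refine ⟨⟨χ (vp q w), ?_⟩, rfl⟩
      by_contra hN
      have h1 := hc (χ (vp q w))
      obtain ⟨i, -, hi⟩ := hs (χ (vp q w)) (by
        rw [card_sigma_fiber (fun a => (c a : ℕ))]
        omega) q ⟨hq, h0, rfl⟩
      exact hne i hi
    · rintro ⟨hw, p, hp, hi, hm, ho⟩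
      refine ⟨hw, fun a => ?_⟩
      have hsub : Set.range (fun k : Fin (c a : ℕ) => p ⟨a, k⟩) ⊆ colorPrimes χ w a := by
        rintro _ ⟨k, rfl⟩
        exact ⟨hp _, (hm ⟨a, k⟩).2, (hm ⟨a, k⟩).1⟩
      have hcard : (Set.range (fun k : Fin (c a : ℕ) => p ⟨a, k⟩)).ncard = c a := by
        rw [Set.ncard_range_of_injective]
        · simp
        · intro k l hkl
          have := hi hkl
          simpa using this
      have h1 := Set.ncard_le_ncard hsub (colorPrimes_finite χ w a)
      have h2 := (c a).2
      by_cases hN : (c a : ℕ) = N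
      · omega
      · have hsup : colorPrimes χ w a ⊆ Set.range (fun k : Fin (c a : ℕ) => p ⟨a, k⟩) := by
          rintro q ⟨hq, h0, hqa⟩
          by_cases hex : ∃ i, p i = q
          · obtain ⟨⟨b, k⟩, rfl⟩ := hex
            have hb : χ (vp (p ⟨b, k⟩) w) = b := (hm ⟨b, k⟩).1
            obtain rfl : b = a := hb.symm.trans hqa
            exact ⟨k, rfl⟩
          · exfalso
            rcases ho q hq (fun i hi => hex ⟨i, hi⟩) h0 with h | h
            · exact h0 h
            · simp only [Set.mem_iUnion, Set.mem_ofPred_eq] at h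
              obtain ⟨⟨b, hb⟩, h⟩ := h
              apply hN
              rw [← hqa, h]
              exact hb
        have h3 := Set.ncard_le_ncard hsup (Set.finite_range _)
        omega
  rw [key]
  apply isSkolemian_of_finite
  · intro i
    rw [isSemilinear_iff_set]
    exact (hχ i.1).sdiff hs0
  · rw [isSemilinear_iff_set]
    exact hs0.union (IsSemilinearSet.iUnion fun a => hχ a.1)
  · left; rfl
  · rintro i ⟨-, h⟩
    exact h rfl

theorem cell_transfer {d n N : ℕ} {C : Type} (χ : (Fin d → ℕ) → C)
    (αs : Fin n → Set (Fin d → ℕ)) (α : Set (Fin d → ℕ))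
    (hα : ∀ v v', χ v = χ v' → v ∈ α → v' ∈ α)
    (hαs : ∀ i v v', χ v = χ v' → v ∈ αs i → v' ∈ αs i)
    (h0 : ∀ i, (0 : Fin d → ℕ) ∉ αs i) (hn : n < N) (c : C → Fin (N + 1))
    {w w' : Fin d → ℕ} (hw : w ∈ cell χ N c) (hw' : w' ∈ cell χ N c)
    (h : w ∈ SkolemDef αs α) : w' ∈ SkolemDef αs α := by
  obtain ⟨-, p, hp, hi, hm, ho⟩ := h
  have hne : ∀ i, vp (p i) w ≠ 0 := fun i e => h0 i (e ▸ hm i)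
  set κ : Fin n → C := fun i => χ (vp (p i) w) with hκ
  have himg : ∀ a, Set.range (fun i : {i // κ i = a} => p i.1) ⊆ colorPrimes χ w a := by
    rintro a _ ⟨⟨i, rfl⟩, rfl⟩
    exact ⟨hp i, hne i, rfl⟩
  have hcard : ∀ a, (Set.range (fun i : {i // κ i = a} => p i.1)).ncard
      = Nat.card {i // κ i = a} := by
    intro a
    rw [Set.ncard_range_of_injective]
    exact hi.comp Subtype.val_injective
  have hle : ∀ a, Nat.card {i // κ i = a} ≤ (colorPrimes χ w a).ncard := fun a => by
    rw [← hcard]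
    exact Set.ncard_le_ncard (himg a) (colorPrimes_finite χ w a)
  have hle' : ∀ a, Nat.card {i // κ i = a} ≤ n := fun a => by
    simpa using Nat.card_le_card_of_injective (Subtype.val : {i // κ i = a} → Fin n)
      Subtype.val_injective
  have hmin : ∀ a, min (colorPrimes χ w a).ncard N = min (colorPrimes χ w' a).ncard N :=
    fun a => (hw.2 a).trans (hw'.2 a).symm
  obtain ⟨p', hp', hm', hs'⟩ := exists_matching (colorPrimes χ w') (colorPrimes_disj χ w')
    (colorPrimes_finite χ w') κ (by
      intro a
      have := hle a
      have := hle' a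
      have := hmin a
      omega)
  refine ⟨hw'.1, p', fun i => (hm' i).1, hp', fun i => hαs i _ _ (hm' i).2.2.symm (hm i), ?_⟩
  intro q hq hqne hq0
  by_cases hlt : Nat.card {i // κ i = χ (vp q w')} < (colorPrimes χ w (χ (vp q w'))).ncard
  · rw [← hcard] at hlt
    obtain ⟨r, hr, hr'⟩ := Set.exists_mem_notMem_of_ncard_lt_ncard hlt (Set.finite_range _)
    refine hα _ _ hr.2.2 (ho r hr.1 ?_ hr.2.1)
    rintro i rfl
    exact hr' ⟨⟨i, hr.2.2⟩, rfl⟩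
  · exfalso
    obtain ⟨i, -, hi⟩ := hs' (χ (vp q w')) (by
      have := hle' (χ (vp q w'))
      have := hmin (χ (vp q w'))
      omega) q ⟨hq, hq0, rfl⟩
    exact hqne i hi

theorem isSemilinearSet_color {d : ℕ} {J : Type} [Finite J] (A : J → Set (Fin d → ℕ))
    (hA : ∀ j, IsSemilinearSet (A j)) (a : Set J) :
    IsSemilinearSet {v | {j | v ∈ A j} = a} := by
  classical
  have : {v | {j | v ∈ A j} = a} = ⋂ j, if j ∈ a then A j else (A j)ᶜ := by
    ext v
    simp only [Set.mem_ofPred_eq, Set.ext_iff, Set.mem_iInter]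
    refine forall_congr' fun j => ?_
    split_ifs with h <;> simp [h]
  rw [this]
  refine IsSemilinearSet.iInter fun j => ?_
  split_ifs
  · exact hA j
  · exact (hA j).compl

/-- Semiskolemian subsets of `(ℕ_{>0})^d` are closed under complementation
within `(ℕ_{>0})^d`. -/
theorem semiskolemian_compl {d : ℕ} (S : Set (Fin d → ℕ)) (hS : IsSemiskolemian S) :
    IsSemiskolemian ({w : Fin d → ℕ | ∀ t, 0 < w t} \ S) := by
  classical
  obtain ⟨m, T, hT, rfl⟩ := hS
  choose n αs α h1 h2 h3 h4 h5 using hT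
  let A : (Σ i : Fin m, Option (Fin (n i))) → Set (Fin d → ℕ) :=
    fun j => j.2.elim (α j.1) (αs j.1)
  have hA : ∀ j, IsSemilinearSet (A j) := by
    rintro ⟨i, _ | k⟩
    · exact (isSemilinear_iff_set _).1 (h2 i)
    · exact (isSemilinear_iff_set _).1 (h1 i k)
  let χ : (Fin d → ℕ) → Set (Σ i : Fin m, Option (Fin (n i))) := fun v => {j | v ∈ A j}
  have hχA : ∀ j v v', χ v = χ v' → v ∈ A j → v' ∈ A j := by
    intro j v v' e hv
    have : j ∈ χ v := hv
    rw [e] at this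
    exact this
  let N := ∑ i, n i + 1
  let I := {c : Set (Σ i : Fin m, Option (Fin (n i))) → Fin (N + 1) //
    Disjoint (cell χ N c) (⋃ i, T i)}
  obtain ⟨M, ⟨e⟩⟩ := Finite.exists_equiv_fin I
  refine ⟨M, fun k => cell χ N (e.symm k).1,
    fun k => isSkolemian_cell χ (isSemilinearSet_color A hA) N _, ?_⟩
  ext w
  simp only [Set.mem_iUnion]
  constructor
  · rintro ⟨hw, hwS⟩
    let c : Set (Σ i : Fin m, Option (Fin (n i))) → Fin (N + 1) :=
      fun a => ⟨min (colorPrimes χ w a).ncard N, by omega⟩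
    have hwc : w ∈ cell χ N c := ⟨hw, fun a => rfl⟩
    refine ⟨e ⟨c, ?_⟩, by simpa using hwc⟩
    rw [Set.disjoint_left]
    intro w' hw' hw'S
    apply hwS
    obtain ⟨i, hi⟩ := Set.mem_iUnion.1 hw'S
    refine Set.mem_iUnion.2 ⟨i, ?_⟩
    rw [h5 i] at hi ⊢
    refine cell_transfer χ (αs i) (α i) (hχA ⟨i, none⟩) (fun k => hχA ⟨i, some k⟩) (h4 i) ?_ c
      hw' hwc hi
    have := Finset.single_le_sum (f := n) (fun _ _ => Nat.zero_le _) (Finset.mem_univ i)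
    exact Nat.lt_succ_of_le this
  · rintro ⟨k, hk⟩
    exact ⟨hk.1, fun h => Set.disjoint_left.1 (e.symm k).2 hk h⟩
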